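/- arXiv:1609.08844 — 3 statements merged into one kernel-verified Lean document; each statement's English description precedes it below -/
import Mathlib

section
/- Let A ⊆ ℝ^n be a nonempty closed monovex set. Then there exists a continuous function φ : A × A × [0,1] → A such that φ(x, y, 0) = x and φ(x, y, 1) = y for all x, y ∈ A. -/
/-- A set `A` in `ℝ^ι` is monovex if any two of its points are connected by a
continuous path inside `A`, each of whose coordinate functions is monotone. -/
def Monovex {ι : Type*} (A : Set (ι → ℝ)) : Prop :=
  ∀ x ∈ A, ∀ y ∈ A, ∃ γ : unitInterval → ι → ℝ,
    Continuous γ ∧ γ 0 = x ∧ γ 1 = y ∧ (∀ t, γ t ∈ A) ∧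
    ∀ i, Monotone (fun t => γ t i) ∨ Antitone (fun t => γ t i)

open Set Filter Topology

theorem mv_select {X : Type*} [TopologicalSpace X] [T2Space X] [ParacompactSpace X] {n : ℕ}
    (W : Set (X × (Fin n → ℝ))) (hW : IsOpen W) (hne : ∀ x, ∃ z, (x, z) ∈ W)
    (hflag : ∀ x (c : Fin n → ℝ) (k : Fin n),
      OrdConnected {u : ℝ | ∃ z, (x, z) ∈ W ∧ (∀ i < k, z i = c i) ∧ z k = u})
    (X0 : Set X) (hX0 : IsClosed X0) (g : X → Fin n → ℝ) (hg : Continuous g)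
    (hgW : ∀ x ∈ X0, (x, g x) ∈ W) :
    ∃ h : X → Fin n → ℝ, Continuous h ∧ (∀ x ∈ X0, h x = g x) ∧ ∀ x, (x, h x) ∈ W := by
  classical
  have key : ∀ k : ℕ, k ≤ n → ∃ h : X → Fin n → ℝ, Continuous h ∧ (∀ x ∈ X0, h x = g x) ∧
      ∀ x, ∃ z, (x, z) ∈ W ∧ ∀ i : Fin n, i.1 < k → z i = h x i := by
    intro k
    induction k with
    | zero =>
      intro _
      refine ⟨g, hg, fun _ _ => rfl, fun x => ?_⟩
      obtain ⟨z, hz⟩ := hne x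
      exact ⟨z, hz, fun i hi => by omega⟩
    | succ k ih =>
      intro hk
      obtain ⟨h, hc, h0, hz⟩ := ih (by omega)
      set K : Fin n := ⟨k, by omega⟩ with hK
      let t : X → Set ℝ := fun x => if x ∈ X0 then {g x K} else
        {u : ℝ | ∃ z, (x, z) ∈ W ∧ (∀ i < K, z i = h x i) ∧ z K = u}
      have ht : ∀ x, Convex ℝ (t x) := by
        intro x
        by_cases hx : x ∈ X0
        · simp only [t, if_pos hx]; exact convex_singleton _
        · simp only [t, if_neg hx]; exact (hflag x (h x) K).convex
      have hmix : ∀ q : X → Fin n → ℝ, Continuous q →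
          Continuous (fun y => (y, fun i : Fin n => if i < K then h y i else q y i)) := by
        intro q hq
        refine continuous_id.prodMk (continuous_pi fun i => ?_)
        by_cases hi : i < K
        · simp only [if_pos hi]; fun_prop
        · simp only [if_neg hi]; fun_prop
      have hloc : ∀ x : X, ∃ U ∈ 𝓝 x, ∃ f : X → ℝ, ContinuousOn f U ∧ ∀ y ∈ U, f y ∈ t y := by
        intro x
        by_cases hx : x ∈ X0
        · have hU : {y | (y, fun i : Fin n => if i < K then h y i else g y i) ∈ W} ∈ 𝓝 x := by
            refine (hW.preimage (hmix g hg)).mem_nhds ?_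
            have : (fun i : Fin n => if i < K then h x i else g x i) = g x := by
              funext i; simp [h0 x hx]
            simp only [mem_preimage, this]
            exact hgW x hx
          refine ⟨_, hU, fun y => g y K, by fun_prop, fun y hy => ?_⟩
          by_cases hy0 : y ∈ X0
          · simp [t, if_pos hy0]
          · simp only [t, if_neg hy0]
            exact ⟨_, hy, fun i hi => by simp [hi], by simp⟩
        · obtain ⟨z, hzW, hzi⟩ := hz x
          have hU : {y | (y, fun i : Fin n => if i < K then h y i else z i) ∈ W} ∈ 𝓝 x := by
            refine (hW.preimage (hmix (fun _ => z) continuous_const)).mem_nhds ?_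
            have : (fun i : Fin n => if i < K then h x i else z i) = z := by
              funext i
              split_ifs with hi
              · exact (hzi i hi).symm
              · rfl
            simp only [mem_preimage, this]
            exact hzW
          refine ⟨_, inter_mem hU (hX0.isOpen_compl.mem_nhds hx), fun y => z K,
            by fun_prop, fun y hy => ?_⟩
          simp only [t, if_neg hy.2]
          exact ⟨_, hy.1, fun i hi => by simp [hi], by simp⟩
      obtain ⟨f, hf⟩ := exists_continuous_forall_mem_convex_of_local ht hloc
      refine ⟨fun x => Function.update (h x) K (f x), by fun_prop, fun x hx => ?_, fun x => ?_⟩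
      · have := hf x
        simp only [t, if_pos hx, mem_singleton_iff] at this
        simp only [this, h0 x hx]; simp
      · by_cases hx : x ∈ X0
        · have := hf x
          simp only [t, if_pos hx, mem_singleton_iff] at this
          refine ⟨g x, hgW x hx, fun i _ => ?_⟩
          simp only [this, h0 x hx]; simp
        · have := hf x
          simp only [t, if_neg hx, mem_ofPred_eq] at this
          obtain ⟨z, h1, h2, h3⟩ := this
          refine ⟨z, h1, fun i hi => ?_⟩
          by_cases hiK : i = K
          · subst hiK; simp [h3]
          · simp only [Function.update_of_ne hiK]
            refine h2 i ?_
            rw [Fin.lt_def]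
            have : i.1 ≠ k := fun h => hiK (Fin.ext h)
            simp only [hK]; omega
  obtain ⟨h, hc, h0, hz⟩ := key n le_rfl
  refine ⟨h, hc, h0, fun x => ?_⟩
  obtain ⟨z, hzW, hzi⟩ := hz x
  have : z = h x := funext fun i => hzi i i.2
  exact this ▸ hzW

theorem mv_step {X : Type*} [TopologicalSpace X] [T2Space X] [ParacompactSpace X] {n : ℕ}
    (A : Set (Fin n → ℝ)) (hA : Monovex A)
    (X0 : Set X) (hX0 : IsClosed X0) (g : X → Fin n → ℝ) (hg : Continuous g)
    (hgA : ∀ x ∈ X0, g x ∈ A) (r : X → ℝ) (hr : Continuous r)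
    (hgr : ∀ x, ∃ a ∈ A, dist a (g x) < r x) (d : ℝ) (hd : 0 < d) :
    ∃ h : X → Fin n → ℝ, Continuous h ∧ (∀ x ∈ X0, h x = g x) ∧
      (∀ x, ∃ a ∈ A, dist a (h x) < d) ∧ ∀ x, dist (g x) (h x) ≤ r x + d := by
  have hrpos : ∀ x, 0 < r x := fun x => by
    obtain ⟨a, _, h⟩ := hgr x
    exact dist_nonneg.trans_lt h
  let W : Set (X × (Fin n → ℝ)) := {p | ∃ a ∈ A, dist a (g p.1) < r p.1 ∧ dist a p.2 < d}
  have hW : IsOpen W := by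
    have : W = ⋃ a ∈ A, {p | dist a (g p.1) < r p.1} ∩ {p | dist a p.2 < d} := by
      ext p; simp [W]; grind
    rw [this]
    refine isOpen_biUnion fun a _ => (isOpen_lt ?_ ?_).inter (isOpen_lt ?_ ?_) <;> fun_prop
  have hsel := mv_select W hW ?_ ?_ X0 hX0 g hg ?_
  · obtain ⟨h, hc, h0, hh⟩ := hsel
    refine ⟨h, hc, h0, fun x => ?_, fun x => ?_⟩
    · obtain ⟨a, ha, _, h2⟩ := hh x
      exact ⟨a, ha, h2⟩
    · obtain ⟨a, ha, h1, h2⟩ := hh x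
      have := dist_triangle_left (g x) (h x) a
      simp only at h1 h2
      linarith
  · intro x
    obtain ⟨a, ha, h⟩ := hgr x
    exact ⟨a, a, ha, h, by simpa using hd⟩
  · intro x c k
    refine ⟨?_⟩
    rintro u1 ⟨z1, ⟨a1, ha1, hb1, hd1⟩, hz1, rfl⟩ u2 ⟨z2, ⟨a2, ha2, hb2, hd2⟩, hz2, rfl⟩ u hu
    obtain ⟨γ, hγ, hγ0, hγ1, hγA, hmono⟩ := hA a1 ha1 a2 ha2
    simp only at hb1 hb2 hd1 hd2
    rw [dist_pi_lt_iff hd] at hd1 hd2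
    rw [dist_pi_lt_iff (hrpos x)] at hb1 hb2
    have hbtw : ∀ t i, (a1 i ≤ γ t i ∧ γ t i ≤ a2 i) ∨ (a2 i ≤ γ t i ∧ γ t i ≤ a1 i) := by
      intro t i
      have e0 : γ 0 i = a1 i := by rw [hγ0]
      have e1 : γ 1 i = a2 i := by rw [hγ1]
      rw [← e0, ← e1]
      rcases hmono i with h | h
      · exact Or.inl ⟨h t.2.1, h t.2.2⟩
      · exact Or.inr ⟨h t.2.2, h t.2.1⟩
    have hbox : ∀ t i (q ρ : ℝ), dist (a1 i) q < ρ → dist (a2 i) q < ρ → dist (γ t i) q < ρ := by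
      intro t i q ρ h1 h2
      rw [Real.dist_eq, abs_lt] at *
      rcases hbtw t i with h | h <;> constructor <;> linarith [h.1, h.2, h1.1, h1.2, h2.1, h2.2]
    let F : unitInterval → ℝ := fun t =>
      γ t k + ((1 - (t : ℝ)) * (z1 k - a1 k) + (t : ℝ) * (z2 k - a2 k))
    have hF : Continuous F := by fun_prop
    have hu' : u ∈ range F := by
      refine mem_range_of_exists_le_of_exists_ge hF ⟨0, ?_⟩ ⟨1, ?_⟩
      · simp [F, hγ0, hu.1]
      · simp [F, hγ1, hu.2]
    obtain ⟨t, ht⟩ := hu'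
    have hFd : dist (γ t k) u < d := by
      rw [← ht]
      have h1 := hd1 k
      have h2 := hd2 k
      rw [Real.dist_eq, abs_lt] at *
      have t0 := t.2.1
      have t1 := t.2.2
      simp only [F]
      rcases eq_or_lt_of_le t0 with h | h
      · rw [← h]; constructor <;> linarith
      · constructor <;> nlinarith
    refine ⟨fun i => if i < k then c i else if i = k then u else γ t i,
      ⟨γ t, hγA t, ?_, ?_⟩, fun i hi => by simp [hi], by simp⟩
    · rw [dist_pi_lt_iff (hrpos x)]
      exact fun i => hbox t i _ _ (hb1 i) (hb2 i)
    · rw [dist_pi_lt_iff hd]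
      intro i
      simp only
      split_ifs with h1 h2
      · refine hbox t i _ _ ?_ ?_
        · rw [← hz1 i h1]; exact hd1 i
        · rw [← hz2 i h1]; exact hd2 i
      · subst h2; exact hFd
      · simpa using hd
  · intro x hx
    exact ⟨g x, hgA x hx, by simpa using hrpos x, by simpa using hd⟩

theorem mv_limit {X : Type*} [TopologicalSpace X] [T2Space X] [ParacompactSpace X] {n : ℕ}
    (A : Set (Fin n → ℝ)) (hcl : IsClosed A) (hA : Monovex A)
    (X0 : Set X) (hX0 : IsClosed X0) (g : X → Fin n → ℝ) (hg : Continuous g)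
    (hgA : ∀ x ∈ X0, g x ∈ A) (r : X → ℝ) (hr : Continuous r)
    (hgr : ∀ x, ∃ a ∈ A, dist a (g x) < r x) :
    ∃ h : X → Fin n → ℝ, Continuous h ∧ (∀ x ∈ X0, h x = g x) ∧ ∀ x, h x ∈ A := by
  let P : ℕ → (X → Fin n → ℝ) → Prop := fun k h =>
    Continuous h ∧ (∀ x ∈ X0, h x = g x) ∧ ∀ x, ∃ a ∈ A, dist a (h x) < (1 / 2 : ℝ) ^ k
  have hstart : ∃ h, P 0 h := by
    obtain ⟨h, h1, h2, h3, _⟩ := mv_step A hA X0 hX0 g hg hgA r hr hgr 1 one_pos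
    exact ⟨h, h1, h2, by simpa using h3⟩
  have hstep : ∀ k h, P k h → ∃ h', P (k + 1) h' ∧
      ∀ x, dist (h x) (h' x) ≤ 2 * (1 / 2 : ℝ) ^ k := by
    rintro k h ⟨h1, h2, h3⟩
    obtain ⟨h', e1, e2, e3, e4⟩ := mv_step A hA X0 hX0 h h1
      (fun x hx => by rw [h2 x hx]; exact hgA x hx) (fun _ => (1 / 2 : ℝ) ^ k)
      continuous_const h3 ((1 / 2 : ℝ) ^ (k + 1)) (by positivity)
    refine ⟨h', ⟨e1, fun x hx => (e2 x hx).trans (h2 x hx), e3⟩, fun x => (e4 x).trans ?_⟩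
    have : (0 : ℝ) < (1 / 2) ^ k := by positivity
    rw [pow_succ]; linarith
  choose! S hS1 hS2 using hstep
  obtain ⟨s0, hs0⟩ := hstart
  let s : ℕ → X → Fin n → ℝ := fun k => Nat.rec s0 (fun k h => S k h) k
  have hs : ∀ k, P k (s k) := by
    intro k
    induction k with
    | zero => exact hs0
    | succ k ih => exact hS1 k _ ih
  have hd : ∀ k x, dist (s k x) (s (k + 1) x) ≤ 2 * (1 / 2 : ℝ) ^ k := fun k => hS2 k _ (hs k)
  have hlim : ∀ x, ∃ l, Tendsto (fun k => s k x) atTop (𝓝 l) := fun x =>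
    cauchySeq_tendsto_of_complete
      (cauchySeq_of_le_geometric (1 / 2) 2 (by norm_num) (fun k => hd k x))
  choose l hl using hlim
  have hpow : Tendsto (fun k : ℕ => (1 / 2 : ℝ) ^ k) atTop (𝓝 0) :=
    tendsto_pow_atTop_nhds_zero_of_lt_one (by norm_num) (by norm_num)
  have hdl : ∀ k x, dist (s k x) (l x) ≤ 4 * (1 / 2 : ℝ) ^ k := by
    intro k x
    have := dist_le_of_le_geometric_of_tendsto (1 / 2) 2 (by norm_num) (fun k => hd k x) (hl x) k
    refine this.trans (le_of_eq ?_)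
    ring
  refine ⟨l, ?_, ?_, ?_⟩
  · have hu : TendstoUniformly s l atTop := by
      rw [Metric.tendstoUniformly_iff]
      intro ε hε
      have h4 : Tendsto (fun k : ℕ => 4 * (1 / 2 : ℝ) ^ k) atTop (𝓝 0) := by
        simpa using hpow.const_mul 4
      filter_upwards [h4.eventually (gt_mem_nhds hε)] with k hk x
      rw [dist_comm]
      exact (hdl k x).trans_lt hk
    exact hu.continuous (Frequently.of_forall fun k => (hs k).1)
  · intro x hx
    refine tendsto_nhds_unique (hl x) ?_
    simp only [fun k => (hs k).2.1 x hx]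
    exact tendsto_const_nhds
  · intro x
    choose a ha1 ha2 using fun k => (hs k).2.2 x
    refine hcl.mem_of_tendsto (b := atTop) (f := a) ?_ (Eventually.of_forall ha1)
    rw [tendsto_iff_dist_tendsto_zero]
    refine squeeze_zero (fun _ => dist_nonneg) (g := fun k => 5 * (1 / 2 : ℝ) ^ k) (fun k => ?_) ?_
    · have := dist_triangle (a k) (s k x) (l x)
      linarith [hdl k x, ha2 k]
    · simpa using hpow.const_mul 5

theorem closed_monovex_path_selection {n : ℕ} (A : Set (Fin n → ℝ))
    (hne : A.Nonempty) (hc : IsClosed A) (hA : Monovex A) :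
    ∃ φ : A × A × unitInterval → A, Continuous φ ∧
      ∀ x y : A, φ (x, y, 0) = x ∧ φ (x, y, 1) = y := by
  let g : A × A × unitInterval → Fin n → ℝ := fun p =>
    (1 - (p.2.2 : ℝ)) • (p.1 : Fin n → ℝ) + (p.2.2 : ℝ) • (p.2.1 : Fin n → ℝ)
  have hg : Continuous g := by fun_prop
  let X0 : Set (A × A × unitInterval) := {p | p.2.2 = 0} ∪ {p | p.2.2 = 1}
  have hX0 : IsClosed X0 :=
    (isClosed_eq (by fun_prop) (by fun_prop)).union (isClosed_eq (by fun_prop) (by fun_prop))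
  have hlim := mv_limit A hc hA X0 hX0 g hg ?_
    (fun p => dist (p.1 : Fin n → ℝ) (g p) + 1) (by fun_prop)
    (fun p => ⟨p.1, p.1.2, by linarith⟩)
  · obtain ⟨h, h1, h2, h3⟩ := hlim
    refine ⟨fun p => ⟨h p, h3 p⟩, by fun_prop, fun x y => ⟨Subtype.ext ?_, Subtype.ext ?_⟩⟩
    · simp [h2 (x, y, 0) (Or.inl rfl), g]
    · simp [h2 (x, y, 1) (Or.inr rfl), g]
  · rintro ⟨x, y, t⟩ (ht | ht)
    · simp only [mem_ofPred_eq] at ht; subst ht; simp [g]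
    · simp only [mem_ofPred_eq] at ht; subst ht; simp [g]
end

section
/- Let A ⊆ ℝ^n be a nonempty closed monovex set and let δ > 0. Then there exists a continuous function g : A × A × [0,1] → A such that for all x, y ∈ A and all t ∈ [0,1]: (1) d_∞(x, g(x,y,0)) ≤ δ and d_∞(y, g(x,y,1)) ≤ δ; (2) the distance (in the sup metric) from g(x,y,t) to the smallest axis-parallel box containing {x, y} is at most δ. -/
def Nr {ι : Type} (ε : ℝ) (T : Set (ι → ℝ)) (p : ι → ℝ) : Prop :=
  ∀ i, (∃ q ∈ T, q i ≤ p i + ε) ∧ (∃ q ∈ T, p i ≤ q i + ε)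

lemma Nr.trans {ι : Type} {ε ε' : ℝ} {T T' : Set (ι → ℝ)} {p : ι → ℝ}
    (h : Nr ε T p) (h' : ∀ q ∈ T, Nr ε' T' q) : Nr (ε + ε') T' p := by
  intro i
  obtain ⟨⟨q, hq, h1⟩, ⟨r, hr, h2⟩⟩ := h i
  obtain ⟨⟨q', hq', h1'⟩, _⟩ := h' q hq i
  obtain ⟨_, ⟨r', hr', h2'⟩⟩ := h' r hr i
  exact ⟨⟨q', hq', by linarith⟩, ⟨r', hr', by linarith⟩⟩

lemma Nr.mono {ι : Type} {ε ε' : ℝ} {T T' : Set (ι → ℝ)} {p : ι → ℝ}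
    (h : Nr ε T p) (hT : T ⊆ T') (he : ε ≤ ε') : Nr ε' T' p := by
  intro i
  obtain ⟨⟨q, hq, h1⟩, ⟨r, hr, h2⟩⟩ := h i
  exact ⟨⟨q, hT hq, by linarith⟩, ⟨r, hT hr, by linarith⟩⟩

lemma Nr.dist_le {ι : Type} [Fintype ι] {ε η : ℝ} {T : Set (ι → ℝ)} {p p0 : ι → ℝ}
    (h : Nr ε T p) (hT : ∀ q ∈ T, dist q p0 ≤ η) (h0 : 0 ≤ ε + η) : dist p p0 ≤ ε + η := by
  rw [dist_pi_le_iff h0]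
  intro i
  obtain ⟨⟨q, hq, h1⟩, ⟨r, hr, h2⟩⟩ := h i
  have a := (dist_le_pi_dist q p0 i).trans (hT q hq)
  have b := (dist_le_pi_dist r p0 i).trans (hT r hr)
  rw [Real.dist_eq, abs_le] at *
  constructor <;> linarith [a.1, a.2, b.1, b.2]

lemma Nr.of_dist {ι : Type} [Fintype ι] {ε : ℝ} {T : Set (ι → ℝ)} {p q : ι → ℝ}
    (hq : q ∈ T) (h : dist p q ≤ ε) : Nr ε T p := by
  intro i
  have a := (dist_le_pi_dist p q i).trans h
  rw [Real.dist_eq, abs_le] at a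
  exact ⟨⟨q, hq, by linarith [a.1]⟩, ⟨q, hq, by linarith [a.2]⟩⟩

def SelP {ι : Type} [Fintype ι] (A : Set (ι → ℝ)) : Prop :=
  ∀ (X : Type) [PseudoMetricSpace X] (a : X → ι → ℝ), (∀ x, a x ∈ A) →
    ∀ ρ > 0, ∀ ε > 0, ∃ h : X → ι → ℝ, UniformContinuous h ∧ (∀ x, h x ∈ A) ∧
      ∀ x, Nr ε (a '' Metric.ball x ρ) (h x)

lemma near_slice {ι : Type} [Fintype ι] {A : Set (ι → ℝ)} (hA : IsCompact A) (i : ι)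
    {τ : ℝ} (hτ : 0 < τ) (c : ℝ) :
    ∃ σ > 0, ∀ p ∈ A, |p i - c| < σ → ∃ q ∈ A, q i = c ∧ dist p q ≤ τ := by
  by_contra! hcon
  choose p hpA hpc hp using fun k : ℕ => hcon (1 / ((k : ℝ) + 1)) (by positivity)
  obtain ⟨q, hq, φ, hφ, hlim⟩ := hA.tendsto_subseq hpA
  have h1 : Filter.Tendsto (fun k => p (φ k) i) Filter.atTop (nhds (q i)) :=
    ((continuous_apply i).tendsto q).comp hlim
  have h2 : Filter.Tendsto (fun k => p k i) Filter.atTop (nhds c) := by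
    rw [tendsto_iff_dist_tendsto_zero]
    refine squeeze_zero (fun _ => dist_nonneg) (fun k => ?_) tendsto_one_div_add_atTop_nhds_zero_nat
    rw [Real.dist_eq]; exact (hpc k).le
  have h3 : q i = c := tendsto_nhds_unique h1 (h2.comp hφ.tendsto_atTop)
  have h4 := (Metric.tendsto_atTop.1 hlim) τ hτ
  obtain ⟨N, hN⟩ := h4
  exact absurd (hN N le_rfl) (not_lt.2 (hp (φ N) q hq h3).le)

lemma slab {ι : Type} [Fintype ι] {A : Set (ι → ℝ)} {i : ι} {τ c σ : ℝ} (hτ : 0 < τ)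
    (hS : SelP (A ∩ {p | p i = c}))
    (hn : ∀ p ∈ A, |p i - c| < σ → ∃ q ∈ A, q i = c ∧ dist p q ≤ τ)
    {X : Type} [PseudoMetricSpace X] (b : X → ι → ℝ) (hb : ∀ x, b x ∈ A) {ρ : ℝ} (hρ : 0 < ρ) :
    ∃ h : X → ι → ℝ, UniformContinuous h ∧ (∀ x, h x ∈ A) ∧
      ∀ x, (∀ x' ∈ Metric.ball x ρ, |b x' i - c| < σ) →
        h x i = c ∧ Nr (2 * τ) (b '' Metric.ball x ρ) (h x) := by
  classical
  rcases isEmpty_or_nonempty X with hX | ⟨⟨x0⟩⟩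
  · exact ⟨b, Metric.uniformContinuous_iff.2 fun _ _ => ⟨1, one_pos, fun {x} => (hX.false x).elim⟩, hb, fun x => (hX.false x).elim⟩
  by_cases hne : ∃ q ∈ A, q i = c
  · obtain ⟨q0, hq0, hq0c⟩ := hne
    have : ∀ x, ∃ q, q ∈ A ∩ {p | p i = c} ∧ (|b x i - c| < σ → dist (b x) q ≤ τ) := by
      intro x
      by_cases hx : |b x i - c| < σ
      · obtain ⟨q, hq, h1, h2⟩ := hn _ (hb x) hx
        exact ⟨q, ⟨hq, h1⟩, fun _ => h2⟩
      · exact ⟨q0, ⟨hq0, hq0c⟩, fun h => absurd h hx⟩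
    choose b' hb' hd using this
    obtain ⟨h, hu, hm, hN⟩ := hS X b' hb' ρ hρ τ hτ
    refine ⟨h, hu, fun x => (hm x).1, fun x hx => ⟨(hm x).2, ?_⟩⟩
    rw [two_mul]
    refine (hN x).trans ?_
    rintro _ ⟨x', hx', rfl⟩
    exact Nr.of_dist ⟨x', hx', rfl⟩ (by rw [dist_comm]; exact hd x' (hx x' hx'))
  · refine ⟨fun _ => b x0, uniformContinuous_const, fun _ => hb x0, fun x hx => ?_⟩
    obtain ⟨q, hq, h1, _⟩ := hn _ (hb x) (hx x (Metric.mem_ball_self hρ))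
    exact absurd ⟨q, hq, h1⟩ hne

/-- Stage 0. -/
lemma stage0 {ι : Type} [Fintype ι] {A : Set (ι → ℝ)} (hM : Monovex A) (i : ι)
    {M : ℝ} (hMb : ∀ p ∈ A, |p i| ≤ M)
    {X : Type} [PseudoMetricSpace X] (a : X → ι → ℝ) (ha : ∀ x, a x ∈ A) {ρ : ℝ} (hρ : 0 < ρ) :
    ∃ u : X → ℝ, UniformContinuous u ∧ (∀ x, |u x| ≤ M) ∧ ∀ s > 0, ∃ b : X → ι → ℝ,
      (∀ x, b x ∈ A) ∧ (∀ x, |b x i - u x| ≤ s) ∧ ∀ x, Nr 0 (a '' Metric.ball x ρ) (b x) := by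
  rcases isEmpty_or_nonempty X with hX | ⟨⟨x0⟩⟩
  · exact ⟨fun _ => 0, uniformContinuous_const, fun x => (hX.false x).elim, fun s _ =>
      ⟨a, ha, fun x => (hX.false x).elim, fun x => (hX.false x).elim⟩⟩
  have hM0 : 0 ≤ M := (abs_nonneg _).trans (hMb _ (ha x0))
  have hlo : ∀ x, -M ≤ a x i := fun x => (abs_le.1 (hMb _ (ha x))).1
  have hhi : ∀ x, a x i ≤ M := fun x => (abs_le.1 (hMb _ (ha x))).2
  obtain ⟨K, hK0, hK⟩ : ∃ K : ℝ, 0 ≤ K ∧ 2 * M + 1 ≤ K * ρ :=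
    ⟨(2 * M + 1) / ρ, by positivity, by field_simp; rfl⟩
  set u : X → ℝ := fun x => ⨅ x', (a x' i + K * dist x x') with hu
  have hbd : ∀ x, BddBelow (Set.range fun x' => a x' i + K * dist x x') := by
    intro x
    refine ⟨-M, ?_⟩
    rintro _ ⟨x', rfl⟩
    have := mul_nonneg hK0 (dist_nonneg (x := x) (y := x'))
    simp only; linarith [hlo x']
  have : Nonempty X := ⟨x0⟩
  have hle : ∀ x x', u x ≤ a x' i + K * dist x x' := fun x x' => ciInf_le (hbd x) x'
  have hle' : ∀ x, u x ≤ a x i := fun x => by simpa using hle x x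
  have hge : ∀ x, -M ≤ u x := fun x => le_ciInf fun x' => by
    have := mul_nonneg hK0 (dist_nonneg (x := x) (y := x'))
    linarith [hlo x']
  have hlip : ∀ x y, u x ≤ u y + K * dist x y := by
    intro x y
    rw [← sub_le_iff_le_add]
    refine le_ciInf fun x' => ?_
    have h1 := hle x x'
    have h2 := mul_le_mul_of_nonneg_left (dist_triangle x y x') hK0
    linarith
  refine ⟨u, ?_, fun x => abs_le.2 ⟨hge x, (hle' x).trans (hhi x)⟩, fun s hs => ?_⟩
  · have : LipschitzWith K.toNNReal u := by
      refine LipschitzWith.of_le_add_mul _ fun x y => ?_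
      rw [Real.coe_toNNReal _ hK0]; exact hlip x y
    exact this.uniformContinuous
  have key : ∀ x, ∃ p, p ∈ A ∧ |p i - u x| ≤ s ∧ Nr 0 (a '' Metric.ball x ρ) p := by
    intro x
    obtain ⟨x', hx'⟩ := exists_lt_of_ciInf_lt (show u x < u x + min s 1 by
      have : 0 < min s 1 := by positivity
      linarith)
    have hs1 := min_le_left s 1
    have hs2 := min_le_right s 1
    have hball : x' ∈ Metric.ball x ρ := by
      rw [Metric.mem_ball, dist_comm]
      by_contra! hcon
      have := mul_le_mul_of_nonneg_left hcon hK0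
      linarith [hlo x', hhi x, hle' x]
    have hKd := mul_nonneg hK0 (dist_nonneg (x := x) (y := x'))
    by_cases hcase : u x ≤ a x' i
    · refine ⟨a x', ha x', abs_le.2 ⟨by linarith, by linarith⟩, ?_⟩
      exact Nr.of_dist ⟨x', hball, rfl⟩ (by simp)
    · push Not at hcase
      obtain ⟨γ, hγ, h0, h1, hm, hmon⟩ := hM _ (ha x') _ (ha x)
      have : u x ∈ Set.Icc (γ 0 i) (γ 1 i) := by
        rw [h0, h1]; exact ⟨hcase.le, hle' x⟩
      obtain ⟨t, ht⟩ := mem_range_of_exists_le_of_exists_ge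
        ((continuous_apply i).comp hγ) ⟨0, this.1⟩ ⟨1, this.2⟩
      refine ⟨γ t, hm t, ?_, ?_⟩
      · simp only [Function.comp] at ht
        rw [ht]; simp [hs.le]
      intro k
      have hx1 : a x ∈ a '' Metric.ball x ρ := ⟨x, Metric.mem_ball_self hρ, rfl⟩
      have hx2 : a x' ∈ a '' Metric.ball x ρ := ⟨x', hball, rfl⟩
      have t0 : (0 : unitInterval) ≤ t := t.2.1
      have t1 : t ≤ (1 : unitInterval) := t.2.2
      rw [← h1] at hx1
      rw [← h0] at hx2
      rcases hmon k with hk | hk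
      · exact ⟨⟨_, hx2, by simpa using hk t0⟩, ⟨_, hx1, by simpa using hk t1⟩⟩
      · exact ⟨⟨_, hx1, by simpa using hk t1⟩, ⟨_, hx2, by simpa using hk t0⟩⟩
  choose b hb1 hb2 hb3 using key
  exact ⟨b, hb1, hb2, hb3⟩

lemma finmod (J : Finset ℤ) (P : ℤ → ℝ → Prop) (hP : ∀ j r r', r' ≤ r → P j r → P j r')
    (h : ∀ j, ∃ r > 0, P j r) : ∃ r > 0, ∀ j ∈ J, P j r := by
  classical
  induction J using Finset.induction_on with
  | empty => exact ⟨1, one_pos, by simp⟩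
  | insert j J _ ih =>
    obtain ⟨r, hr, h1⟩ := ih
    obtain ⟨r', hr', h2⟩ := h j
    refine ⟨min r r', lt_min hr hr', fun k hk => ?_⟩
    rcases Finset.mem_insert.1 hk with rfl | hk
    · exact hP _ _ _ (min_le_right _ _) h2
    · exact hP _ _ _ (min_le_left _ _) (h1 k hk)

lemma finJ (l B : ℝ) (hl : 0 < l) : ∃ J : Finset ℤ, ∀ j : ℤ, |(j : ℝ) * l| ≤ B → j ∈ J := by
  refine ⟨Finset.Icc (-⌈B / l⌉) ⌈B / l⌉, fun j hj => ?_⟩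
  rw [abs_mul, abs_of_pos hl, ← le_div_iff₀ hl, abs_le] at hj
  have h := Int.le_ceil (B / l)
  rw [Finset.mem_Icc]
  constructor
  · have : (-(⌈B / l⌉ : ℤ) : ℝ) ≤ (j : ℝ) := by linarith [hj.1]
    exact_mod_cast this
  · have : (j : ℝ) ≤ (⌈B / l⌉ : ℤ) := by linarith [hj.2]
    exact_mod_cast this

lemma ucmod {ι : Type} [Fintype ι] {X : Type} [PseudoMetricSpace X] (J : Finset ℤ)
    (h : ℤ → X → ι → ℝ) (hu : ∀ j, UniformContinuous (h j)) {τ : ℝ} (hτ : 0 < τ) :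
    ∃ r > 0, ∀ j ∈ J, ∀ x x', dist x x' < r → dist (h j x) (h j x') ≤ τ := by
  refine finmod J (fun j r => ∀ x x', dist x x' < r → dist (h j x) (h j x') ≤ τ) ?_ ?_
  · intro j r r' hr h x x' hx
    exact h x x' (hx.trans_le hr)
  · intro j
    obtain ⟨r, hr, h1⟩ := Metric.uniformContinuous_iff.1 (hu j) τ hτ
    exact ⟨r, hr, fun x x' hx => (h1 hx).le⟩

lemma stepJ {ι : Type} [Fintype ι] {A : Set (ι → ℝ)} (hA : IsCompact A) (hM : Monovex A) (i : ι)
    (hS : ∀ c, SelP (A ∩ {p | p i = c}))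
    {X : Type} [PseudoMetricSpace X] (a : X → ι → ℝ) (ha : ∀ x, a x ∈ A) {ρ τ : ℝ} (hρ : 0 < ρ)
    (hτ : 0 < τ) :
    ∃ b : X → ι → ℝ, (∀ x, b x ∈ A) ∧
      (∃ r > 0, ∀ x x', dist x x' < r → dist (b x) (b x') ≤ 7 * τ) ∧
      ∀ x, Nr (4 * τ) (a '' Metric.ball x ρ) (b x) := by
  classical
  obtain ⟨M, hM0, hMb⟩ : ∃ M : ℝ, 0 ≤ M ∧ ∀ p ∈ A, |p i| ≤ M := by
    obtain ⟨R, hR⟩ := hA.isBounded.exists_norm_le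
    exact ⟨max R 0, le_max_right _ _, fun p hp =>
      ((norm_le_pi_norm p i).trans (hR p hp)).trans (le_max_left _ _)⟩
  obtain ⟨u, hu, huM, hb0⟩ := stage0 hM i hMb a ha (show 0 < ρ / 3 by positivity)
  choose σ hσ hn using near_slice hA i hτ
  -- the mesh
  obtain ⟨l, hl, hl1, hleb⟩ : ∃ l : ℝ, 0 < l ∧ l ≤ 1 ∧ ∀ v : ℝ, |v| ≤ M + 1 →
      ∃ c, ∀ v', |v' - v| ≤ 3 * l → |v' - c| < σ c := by
    obtain ⟨d, hd, h⟩ := lebesgue_number_lemma_of_metric (s := Set.Icc (-(M + 1)) (M + 1))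
      (c := fun c : ℝ => Metric.ball c (σ c)) isCompact_Icc (fun _ => Metric.isOpen_ball)
      (fun v _ => Set.mem_iUnion.2 ⟨v, Metric.mem_ball_self (hσ v)⟩)
    refine ⟨min (d / 4) 1, by positivity, min_le_right _ _, fun v hv => ?_⟩
    obtain ⟨c, hc⟩ := h v (abs_le.1 hv)
    refine ⟨c, fun v' hv' => ?_⟩
    have := min_le_left (d / 4) 1
    have h2 := hc (show v' ∈ Metric.ball v d by
      rw [Metric.mem_ball, Real.dist_eq]; linarith)
    rwa [Metric.mem_ball, Real.dist_eq] at h2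
  obtain ⟨J, hJ⟩ := finJ l (M + l) hl
  have hJu : ∀ x (j : ℤ), |u x - j * l| ≤ l → j ∈ J := by
    intro x j h
    refine hJ j ?_
    have h1 := huM x
    rw [abs_le] at *
    constructor <;> linarith [h.1, h.2, h1.1, h1.2]
  obtain ⟨s0, hs0, hs0J⟩ := finmod J (fun j r => 4 * r ≤ σ (j * l))
    (fun j r r' h h' => by linarith)
    (fun j => ⟨σ (j * l) / 4, by have := hσ (j * l); positivity, by linarith⟩)
  obtain ⟨s, hs, hsl, hsJ⟩ : ∃ s : ℝ, 0 < s ∧ 4 * s ≤ l ∧ ∀ j ∈ J, 4 * s ≤ σ (j * l) :=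
    ⟨min s0 (l / 4), by positivity, by linarith [min_le_right s0 (l / 4)],
      fun j hj => by linarith [min_le_left s0 (l / 4), hs0J j hj]⟩
  obtain ⟨w, hw, hwu⟩ := Metric.uniformContinuous_iff.1 hu (s / 2) (by positivity)
  have hwu' : ∀ x x', dist x x' < w → |u x - u x'| < s / 2 := fun x x' h => by
    have := hwu h; rwa [Real.dist_eq] at this
  obtain ⟨b0, hb0A, hb0u, hb0N⟩ := hb0 s hs
  -- stage 1
  set ρ1 := min (ρ / 3) w with hρ1d
  have hρ1 : 0 < ρ1 := by positivity
  choose h hhu hhA hhN using fun j : ℤ => slab hτ (hS (j * l)) (hn (j * l)) b0 hb0A hρ1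
  have hh : ∀ x (j : ℤ), |u x - j * l| ≤ s →
      h j x i = j * l ∧ Nr (2 * τ) (b0 '' Metric.ball x ρ1) (h j x) := by
    intro x j hx
    refine hhN j x fun x' hx' => ?_
    have h1 := hwu' x' x ((Metric.mem_ball.1 hx').trans_le (min_le_right _ _))
    have h2 := hb0u x'
    have h3 := hsJ j (hJu x j (by linarith))
    rw [abs_lt] at *
    rw [abs_le] at *
    constructor <;> linarith [h1.1, h1.2, h2.1, h2.2, hx.1, hx.2]
  set b1 : X → ι → ℝ := fun x => if |u x - (⌊u x / l + 1 / 2⌋ : ℤ) * l| ≤ s then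
    h ⌊u x / l + 1 / 2⌋ x else b0 x with hb1
  have hb1e : ∀ x (j : ℤ), |u x - j * l| ≤ s → b1 x = h j x := by
    intro x j hx
    have : ⌊u x / l + 1 / 2⌋ = j := by
      rw [Int.floor_eq_iff]
      rw [abs_le] at hx
      constructor
      · rw [← sub_le_iff_le_add, le_div_iff₀ hl]; nlinarith [hx.1, hx.2]
      · rw [← lt_sub_iff_add_lt, div_lt_iff₀ hl]; nlinarith [hx.1, hx.2]
    rw [hb1]; simp only [this]; rw [if_pos hx]
  have hb1A : ∀ x, b1 x ∈ A := by
    intro x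
    by_cases hx : |u x - (⌊u x / l + 1 / 2⌋ : ℤ) * l| ≤ s
    · rw [hb1e x _ hx]; exact hhA _ x
    · rw [hb1]; simp only [if_neg hx]; exact hb0A x
  have hb1u : ∀ x, |b1 x i - u x| ≤ s := by
    intro x
    by_cases hx : |u x - (⌊u x / l + 1 / 2⌋ : ℤ) * l| ≤ s
    · rw [hb1e x _ hx, (hh x _ hx).1, abs_sub_comm]; exact hx
    · rw [hb1]; simp only [if_neg hx]; exact hb0u x
  have hb1N : ∀ x, Nr (2 * τ) (b0 '' Metric.ball x ρ1) (b1 x) := by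
    intro x
    by_cases hx : |u x - (⌊u x / l + 1 / 2⌋ : ℤ) * l| ≤ s
    · rw [hb1e x _ hx]; exact (hh x _ hx).2
    · rw [hb1]; simp only [if_neg hx]
      exact Nr.of_dist ⟨x, Metric.mem_ball_self hρ1, rfl⟩ (by simp; positivity)
  obtain ⟨r0, hr0, hr0J⟩ := ucmod J h hhu hτ
  set r1 := min r0 w with hr1d
  have hr1 : 0 < r1 := by positivity
  have hb1c : ∀ x x' (j : ℤ), |u x - j * l| ≤ s / 2 → dist x x' < r1 →
      dist (b1 x) (b1 x') ≤ τ := by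
    intro x x' j hx hd
    have h1 := hwu' x x' (hd.trans_le (min_le_right _ _))
    rw [hb1e x j (by linarith), hb1e x' j (by
      rw [abs_lt] at h1
      rw [abs_le] at *
      constructor <;> linarith [h1.1, h1.2, hx.1, hx.2])]
    exact hr0J j (hJu x j (by linarith)) x x' (hd.trans_le (min_le_left _ _))
  -- stage 2
  set ρ2 := min (ρ / 3) r1 with hρ2d
  have hρ2 : 0 < ρ2 := by positivity
  have hcell : ∀ j : ℤ, ∃ c, j ∈ J → |(j : ℝ) * l| ≤ M + 1 → ∀ v', |v' - j * l| ≤ 3 * l → |v' - c| < σ c := by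
    intro j
    by_cases hj : |(j : ℝ) * l| ≤ M + 1
    · obtain ⟨c, hc⟩ := hleb _ hj
      exact ⟨c, fun _ _ => hc⟩
    · exact ⟨0, fun _ h => absurd h hj⟩
  choose c hc using hcell
  choose k hku hkA hkN using fun j : ℤ => slab hτ (hS (c j)) (hn (c j)) b1 hb1A hρ2
  have hfl : ∀ x, (⌊u x / l⌋ : ℝ) * l ≤ u x ∧ u x < ((⌊u x / l⌋ : ℝ) + 1) * l := by
    intro x
    constructor
    · rw [← le_div_iff₀ hl]; exact Int.floor_le _
    · rw [← div_lt_iff₀ hl]; exact Int.lt_floor_add_one _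
  have hflJ : ∀ x, ⌊u x / l⌋ ∈ J := fun x => hJu x _ (by
    have := hfl x
    rw [abs_le]; constructor <;> nlinarith [this.1, this.2])
  set b2 : X → ι → ℝ := fun x => k ⌊u x / l⌋ x with hb2
  have hb2N : ∀ x, Nr (2 * τ) (b1 '' Metric.ball x ρ2) (b2 x) := by
    intro x
    refine (hkN _ x fun x' hx' => ?_).2
    have h0 := hfl x
    have hM' := huM x
    refine hc _ (hflJ x) ?_ _ ?_
    · rw [abs_le] at *
      constructor <;> nlinarith [h0.1, h0.2, hM'.1, hM'.2]
    · have h1 := hwu' x' x ((Metric.mem_ball.1 hx').trans_le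
        ((min_le_right _ _).trans (min_le_right _ _)))
      have h2 := hb1u x'
      rw [abs_lt] at h1
      rw [abs_le] at *
      constructor <;> nlinarith [h0.1, h0.2, h1.1, h1.2, h2.1, h2.2]
  obtain ⟨r2, hr2, hr2J⟩ := ucmod J k hku hτ
  -- closeness near grid levels
  have hnear : ∀ x (j : ℤ), |u x - j * l| ≤ s / 2 → dist (b2 x) (b1 x) ≤ 3 * τ := by
    intro x j hx
    have : dist (b2 x) (b1 x) ≤ 2 * τ + τ := by
      refine (hb2N x).dist_le ?_ (by positivity)
      rintro _ ⟨x', hx', rfl⟩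
      rw [dist_comm]
      refine hb1c x x' j hx ?_
      rw [dist_comm]
      exact (Metric.mem_ball.1 hx').trans_le (min_le_right _ _)
    linarith
  have hcross : ∀ x x', dist x x' < min r2 r1 → ⌊u x / l⌋ < ⌊u x' / l⌋ →
      dist (b2 x) (b2 x') ≤ 7 * τ := by
    intro x x' hd hlt
    have h1 := hwu' x x' (hd.trans_le ((min_le_right _ _).trans (min_le_right _ _)))
    have h2 := hfl x
    have h3 := hfl x'
    have h4 : (⌊u x / l⌋ : ℝ) + 1 ≤ ⌊u x' / l⌋ := by exact_mod_cast hlt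
    have h5 := mul_le_mul_of_nonneg_right h4 hl.le
    rw [abs_lt] at h1
    have e1 : |u x - ⌊u x' / l⌋ * l| ≤ s / 2 := by
      rw [abs_le]; constructor <;> linarith [h1.1, h1.2, h2.2, h3.1]
    have e2 : |u x' - ⌊u x' / l⌋ * l| ≤ s / 2 := by
      rw [abs_le]; constructor <;> linarith [h1.1, h1.2, h2.2, h3.1]
    have d1 := hnear x _ e1
    have d2 := hnear x' _ e2
    have d3 := hb1c x x' _ e1 (hd.trans_le (min_le_right _ _))
    have t1 := dist_triangle (b2 x) (b1 x) (b2 x')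
    have t2 := dist_triangle (b1 x) (b1 x') (b2 x')
    rw [dist_comm (b1 x') (b2 x')] at t2
    linarith
  refine ⟨b2, fun x => hkA _ x, ⟨min r2 r1, by positivity, fun x x' hd => ?_⟩, fun x => ?_⟩
  · rcases lt_trichotomy ⌊u x / l⌋ ⌊u x' / l⌋ with hlt | heq | hlt
    · exact hcross x x' hd hlt
    · have := hr2J _ (hflJ x) x x' (hd.trans_le (min_le_left _ _))
      simp only [hb2]
      rw [← heq]
      linarith
    · rw [dist_comm] at hd ⊢
      exact hcross x' x hd hlt
  · have : Nr (2 * τ + (2 * τ + 0)) (a '' Metric.ball x ρ) (b2 x) := by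
      refine (hb2N x).trans ?_
      rintro _ ⟨y, hy, rfl⟩
      refine (hb1N y).trans ?_
      rintro _ ⟨z, hz, rfl⟩
      refine (hb0N z).mono (Set.image_mono ?_) le_rfl
      intro v hv
      rw [Metric.mem_ball] at *
      have i1 : ρ2 ≤ ρ / 3 := min_le_left _ _
      have i2 : ρ1 ≤ ρ / 3 := min_le_left _ _
      have t1 := dist_triangle v z x
      have t2 := dist_triangle z y x
      linarith
    exact this.mono subset_rfl (by linarith)

lemma sel_step {ι : Type} [Fintype ι] {A : Set (ι → ℝ)} (hA : IsCompact A) (hM : Monovex A)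
    (i : ι) (hS : ∀ c, SelP (A ∩ {p | p i = c})) : SelP A := by
  intro X _ a ha ρ hρ ε hε
  have hJ : ∀ (n : ℕ) (f : {f : X → ι → ℝ // ∀ x, f x ∈ A} × {r : ℝ // 0 < r}),
      ∃ f' : {f : X → ι → ℝ // ∀ x, f x ∈ A} × {r : ℝ // 0 < r},
        (∀ x x', dist x x' < f'.2.1 → dist (f'.1.1 x) (f'.1.1 x') ≤ ε / 8 / 2 ^ n) ∧
        ∀ x, Nr (ε / 8 / 2 ^ n) (f.1.1 '' Metric.ball x f.2.1) (f'.1.1 x) := by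
    intro n f
    have hp : 0 < ε / 8 / 2 ^ n := by positivity
    obtain ⟨b, hb, ⟨r, hr, hbr⟩, hN⟩ := stepJ hA hM i hS f.1.1 f.1.2 f.2.2
      (show 0 < ε / 8 / 2 ^ n / 7 by positivity)
    refine ⟨⟨⟨b, hb⟩, ⟨r, hr⟩⟩, fun x x' h => ?_, fun x => (hN x).mono subset_rfl ?_⟩
    · have := hbr x x' h
      simp only; linarith
    · linarith
  choose F hF1 hF2 using hJ
  let f : ℕ → {f : X → ι → ℝ // ∀ x, f x ∈ A} × {r : ℝ // 0 < r} :=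
    fun n => Nat.rec (F 0 (⟨a, ha⟩, ⟨ρ, hρ⟩)) (fun n f => F (n + 1) f) n
  have hf0 : f 0 = F 0 (⟨a, ha⟩, ⟨ρ, hρ⟩) := rfl
  have hfs : ∀ n, f (n + 1) = F (n + 1) (f n) := fun n => rfl
  have hmod : ∀ n x x', dist x x' < (f n).2.1 →
      dist ((f n).1.1 x) ((f n).1.1 x') ≤ ε / 8 / 2 ^ n := by
    intro n
    cases n with
    | zero => rw [hf0]; exact hF1 0 _
    | succ n => rw [hfs]; exact hF1 (n + 1) _
  have hd : ∀ x n, dist ((f n).1.1 x) ((f (n + 1)).1.1 x) ≤ ε / 2 / 2 / 2 ^ n := by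
    intro x n
    have hN := hF2 (n + 1) (f n) x
    rw [← hfs] at hN
    have h1 : dist ((f (n + 1)).1.1 x) ((f n).1.1 x) ≤ ε / 8 / 2 ^ (n + 1) + ε / 8 / 2 ^ n := by
      refine hN.dist_le ?_ (by positivity)
      rintro _ ⟨x', hx', rfl⟩
      exact hmod n x' x hx'
    rw [dist_comm]
    refine h1.trans ?_
    rw [pow_succ]
    have : 0 < ε / 2 ^ n := by positivity
    have e1 : ε / 8 / (2 ^ n * 2) + ε / 8 / 2 ^ n = (3 / 16) * (ε / 2 ^ n) := by field_simp; norm_num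
    have e2 : ε / 2 / 2 / 2 ^ n = (1 / 4) * (ε / 2 ^ n) := by field_simp; norm_num
    rw [e1, e2]; linarith
  have hcau : ∀ x, CauchySeq fun n => (f n).1.1 x := fun x => cauchySeq_of_le_geometric_two (hd x)
  choose h hh using fun x => cauchySeq_tendsto_of_complete (hcau x)
  have hdist : ∀ n x, dist ((f n).1.1 x) (h x) ≤ ε / 2 / 2 ^ n := fun n x =>
    dist_le_of_le_geometric_two_of_tendsto (hd x) (hh x) n
  refine ⟨h, ?_, fun x => hA.isClosed.mem_of_tendsto (hh x) (Filter.Eventually.of_forall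
    fun n => (f n).1.2 x), fun x => ?_⟩
  · rw [Metric.uniformContinuous_iff]
    intro η hη
    obtain ⟨n, hn⟩ : ∃ n : ℕ, 2 * ε / 2 ^ n < η := by
      obtain ⟨n, hn⟩ := exists_pow_lt_of_lt_one (show 0 < η / (2 * ε) by positivity)
        (show (1 / 2 : ℝ) < 1 by norm_num)
      refine ⟨n, ?_⟩
      rw [lt_div_iff₀ (by positivity)] at hn
      rw [one_div, inv_pow] at hn
      calc _ = (2 ^ n)⁻¹ * (2 * ε) := by field_simp
        _ < η := hn
    refine ⟨(f n).2.1, (f n).2.2, fun {x x'} hx => ?_⟩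
    have h1 := hdist n x
    have h2 := hdist n x'
    have h3 := hmod n x x' hx
    have t1 := dist_triangle (h x) ((f n).1.1 x) (h x')
    have t2 := dist_triangle ((f n).1.1 x) ((f n).1.1 x') (h x')
    rw [dist_comm (h x) ((f n).1.1 x)] at t1
    have : 0 < ε / 2 ^ n := by positivity
    have e1 : ε / 2 / 2 ^ n = 1 / 2 * (ε / 2 ^ n) := by ring
    have e2 : ε / 8 / 2 ^ n = 1 / 8 * (ε / 2 ^ n) := by ring
    have e3 : 2 * ε / 2 ^ n = 2 * (ε / 2 ^ n) := by ring
    rw [e1] at h1 h2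
    rw [e2] at h3
    rw [e3] at hn
    linarith
  · have h1 := hdist 0 x
    have h2 := hF2 0 (⟨a, ha⟩, ⟨ρ, hρ⟩) x
    rw [← hf0] at h2
    rw [dist_comm] at h1
    have h3 : Nr (ε / 2 / 2 ^ 0) {(f 0).1.1 x} (h x) := Nr.of_dist rfl h1
    refine (h3.trans (ε' := ε / 8 / 2 ^ 0) ?_).mono subset_rfl (by norm_num; linarith)
    rintro _ rfl
    exact h2

lemma Monovex.inter_slice {ι : Type} {A : Set (ι → ℝ)} (hM : Monovex A) (i : ι) (c : ℝ) :
    Monovex (A ∩ {p | p i = c}) := by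
  rintro x ⟨hx, hxc⟩ y ⟨hy, hyc⟩
  obtain ⟨γ, h1, h2, h3, h4, h5⟩ := hM x hx y hy
  refine ⟨γ, h1, h2, h3, fun t => ⟨h4 t, ?_⟩, h5⟩
  have t0 : (0 : unitInterval) ≤ t := t.2.1
  have t1 : t ≤ (1 : unitInterval) := t.2.2
  change x i = c at hxc
  change y i = c at hyc
  change γ t i = c
  rw [← h2] at hxc
  rw [← h3] at hyc
  rcases h5 i with h | h
  · have a := h t0
    have b := h t1
    simp only at a b
    linarith
  · have a := h t0
    have b := h t1
    simp only at a b
    linarith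

lemma Monovex.inter_ball {ι : Type} [Fintype ι] {A : Set (ι → ℝ)} (hM : Monovex A) (p : ι → ℝ)
    {R : ℝ} (hR : 0 ≤ R) : Monovex (A ∩ Metric.closedBall p R) := by
  rintro x ⟨hx, hxc⟩ y ⟨hy, hyc⟩
  obtain ⟨γ, h1, h2, h3, h4, h5⟩ := hM x hx y hy
  refine ⟨γ, h1, h2, h3, fun t => ⟨h4 t, ?_⟩, h5⟩
  have t0 : (0 : unitInterval) ≤ t := t.2.1
  have t1 : t ≤ (1 : unitInterval) := t.2.2
  rw [← h2] at hxc
  rw [← h3] at hyc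
  rw [Metric.mem_closedBall, dist_pi_le_iff hR] at *
  intro i
  have hxc := hxc i
  have hyc := hyc i
  rw [Real.dist_eq, abs_le] at *
  rcases h5 i with h | h
  · have a := h t0
    have b := h t1
    simp only at a b
    constructor <;> linarith [hxc.1, hxc.2, hyc.1, hyc.2]
  · have a := h t0
    have b := h t1
    simp only at a b
    constructor <;> linarith [hxc.1, hxc.2, hyc.1, hyc.2]

lemma sel_compact {ι : Type} [Fintype ι] (F : Finset ι) : ∀ A : Set (ι → ℝ), IsCompact A →
    Monovex A → (∀ p ∈ A, ∀ q ∈ A, ∀ i ∉ F, p i = q i) → SelP A := by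
  classical
  induction F using Finset.induction_on with
  | empty =>
    intro A _ _ hc X _ a ha ρ hρ ε hε
    have he : ∀ x x', a x = a x' := fun x x' => funext fun i => hc _ (ha x) _ (ha x') i (by simp)
    refine ⟨a, ?_, ha, fun x => Nr.of_dist ⟨x, Metric.mem_ball_self hρ, rfl⟩ (by simp [hε.le])⟩
    rw [Metric.uniformContinuous_iff]
    intro η hη
    exact ⟨1, one_pos, fun {x x'} _ => by rw [he x x']; simpa using hη⟩
  | insert i F _ ih =>
    intro A hA hM hc
    refine sel_step hA hM i fun c => ih _ ?_ (hM.inter_slice i c) ?_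
    · exact hA.inter_right (isClosed_eq (continuous_apply i) continuous_const)
    · rintro p ⟨hp, hpc⟩ q ⟨hq, hqc⟩ j hj
      by_cases hji : j = i
      · subst hji; exact hpc.trans hqc.symm
      · exact hc p hp q hq j (by simp [hji, hj])

lemma exF {ι : Type} [Fintype ι] {A : Set (ι → ℝ)} (hc : IsClosed A) (hA : Monovex A)
    {p0 : ι → ℝ} (hp0 : p0 ∈ A) (m : ℕ) {ε : ℝ} (hε : 0 < ε) :
    ∃ F : A × A × unitInterval → A, Continuous F ∧ (∀ z, dist (F z : ι → ℝ) p0 ≤ m + 1) ∧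
      ∀ x y : A, dist (x : ι → ℝ) p0 ≤ m → dist (y : ι → ℝ) p0 ≤ m →
        Nr ε {(x : ι → ℝ)} (F (x, y, 0)) ∧ Nr ε {(y : ι → ℝ)} (F (x, y, 1)) ∧
        ∀ t, Nr ε {(x : ι → ℝ), (y : ι → ℝ)} (F (x, y, t)) := by
  classical
  have hm : (0 : ℝ) ≤ m + 1 := by positivity
  have hS : SelP (A ∩ Metric.closedBall p0 ((m : ℝ) + 1)) :=
    sel_compact Finset.univ _ ((isCompact_closedBall _ _).inter_left hc) (hA.inter_ball p0 hm)
      (fun p _ q _ i hi => absurd (Finset.mem_univ i) hi)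
  let w : A × A × unitInterval → ι → ℝ := fun z => if (z.2.2 : ℝ) < 1 / 2 then z.1 else z.2.1
  have hw : ∀ z, w z ∈ A := by
    intro z; simp only [w]; split_ifs
    · exact z.1.2
    · exact z.2.1.2
  let a : A × A × unitInterval → ι → ℝ := fun z => if dist (w z) p0 ≤ m + 1 then w z else p0
  have ha : ∀ z, a z ∈ A ∩ Metric.closedBall p0 ((m : ℝ) + 1) := by
    intro z; simp only [a]; split_ifs with h
    · exact ⟨hw z, h⟩
    · exact ⟨hp0, Metric.mem_closedBall_self hm⟩
  obtain ⟨F, hFu, hFA, hFN⟩ := hS _ a ha (min (ε / 2) (1 / 4)) (by positivity) (ε / 2) (by positivity)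
  have i1 := min_le_left (ε / 2) (1 / 4)
  have i2 := min_le_right (ε / 2) (1 / 4)
  refine ⟨fun z => ⟨F z, (hFA z).1⟩, hFu.continuous.subtype_mk _, fun z => (hFA z).2, ?_⟩
  intro x y hx hy
  have key : ∀ t : unitInterval, ∀ z ∈ Metric.ball (x, y, t) (min (ε / 2) (1 / 4)),
      a z = w z ∧ dist (z.1 : ι → ℝ) x ≤ ε / 2 ∧ dist (z.2.1 : ι → ℝ) y ≤ ε / 2 ∧
        |(z.2.2 : ℝ) - t| < 1 / 4 := by
    intro t z hz
    rw [Metric.mem_ball, Prod.dist_eq, Prod.dist_eq, max_lt_iff, max_lt_iff] at hz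
    obtain ⟨h1, h2, h3⟩ := hz
    rw [Subtype.dist_eq] at h1 h2 h3
    rw [Real.dist_eq] at h3
    simp only at h1 h2 h3
    refine ⟨?_, by linarith, by linarith, by linarith⟩
    have : dist (w z) p0 ≤ m + 1 := by
      simp only [w]; split_ifs
      · linarith [dist_triangle (z.1 : ι → ℝ) x p0]
      · linarith [dist_triangle (z.2.1 : ι → ℝ) y p0]
    simp only [a]; rw [if_pos this]
  refine ⟨?_, ?_, fun t => ?_⟩
  · refine ((hFN (x, y, 0)).trans (ε' := ε / 2) ?_).mono subset_rfl (by linarith)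
    rintro _ ⟨z, hz, rfl⟩
    obtain ⟨k1, k2, k3, k4⟩ := key 0 z hz
    rw [k1]
    have : (z.2.2 : ℝ) < 1 / 2 := by
      have := (abs_lt.1 k4).2
      simp only [Set.Icc.coe_zero] at this
      linarith
    simp only [w]; rw [if_pos this]
    exact Nr.of_dist rfl k2
  · refine ((hFN (x, y, 1)).trans (ε' := ε / 2) ?_).mono subset_rfl (by linarith)
    rintro _ ⟨z, hz, rfl⟩
    obtain ⟨k1, k2, k3, k4⟩ := key 1 z hz
    rw [k1]
    have : ¬ (z.2.2 : ℝ) < 1 / 2 := by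
      have := (abs_lt.1 k4).1
      simp only [Set.Icc.coe_one] at this
      linarith
    simp only [w]; rw [if_neg this]
    exact Nr.of_dist rfl k3
  · refine ((hFN (x, y, t)).trans (ε' := ε / 2) ?_).mono subset_rfl (by linarith)
    rintro _ ⟨z, hz, rfl⟩
    obtain ⟨k1, k2, k3, k4⟩ := key t z hz
    rw [k1]
    simp only [w]; split_ifs
    · exact Nr.of_dist (Or.inl rfl) k2
    · exact Nr.of_dist (Or.inr rfl) k3

lemma exG {ι : Type} [Fintype ι] {A : Set (ι → ℝ)} (hc : IsClosed A) (hA : Monovex A)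
    {p0 : ι → ℝ} (hp0 : p0 ∈ A) {δ : ℝ} (hδ : 0 < δ) :
    ∃ g : A × A × unitInterval → A, Continuous g ∧
      ∀ x y : A, Nr δ {(x : ι → ℝ)} (g (x, y, 0)) ∧ Nr δ {(y : ι → ℝ)} (g (x, y, 1)) ∧
        ∀ t, Nr δ {(x : ι → ℝ), (y : ι → ℝ)} (g (x, y, t)) := by
  choose F hFc hFb hF using fun m : ℕ => exF hc hA hp0 m (show 0 < δ / 16 / 2 ^ m by positivity)
  let N : A × A × unitInterval → ℝ := fun z => max (dist (z.1 : ι → ℝ) p0) (dist (z.2.1 : ι → ℝ) p0)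
  have hN : Continuous N := by fun_prop
  have hN0 : ∀ z, 0 ≤ N z := fun z => dist_nonneg.trans (le_max_left _ _)
  let μ : ℕ → A × A × unitInterval → unitInterval := fun m z =>
    Set.projIcc 0 1 zero_le_one (N z - m + 2)
  have hμ : ∀ m, Continuous (μ m) := fun m => by
    simp only [μ]; exact continuous_projIcc.comp (by fun_prop)
  obtain ⟨h, h0, hs⟩ : ∃ h : ℕ → A × A × unitInterval → A, h 0 = F 0 ∧
      ∀ m z, h (m + 1) z = F (m + 2) (h m z, F (m + 1) z, μ (m + 1) z) :=
    ⟨fun m => Nat.rec (motive := fun _ => A × A × unitInterval → A) (F 0)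
      (fun m f z => F (m + 2) (f z, F (m + 1) z, μ (m + 1) z)) m, rfl, fun _ _ => rfl⟩
  have hcont : ∀ m, Continuous (h m) := by
    intro m
    induction m with
    | zero => rw [h0]; exact hFc 0
    | succ m ih => rw [funext (hs m)]; exact (hFc (m + 2)).comp (ih.prodMk ((hFc (m + 1)).prodMk (hμ (m + 1))))
  have hb : ∀ (m : ℕ) (z : A × A × unitInterval), dist ((h m z : A) : ι → ℝ) p0 ≤ (m + 2 : ℕ) := by
    intro m z
    cases m with
    | zero => rw [h0]; have := hFb 0 z; push_cast at *; linarith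
    | succ m => rw [hs]; have := hFb (m + 2) (h m z, F (m + 1) z, μ (m + 1) z); push_cast at *; linarith
  have hb' : ∀ (m : ℕ) (z : A × A × unitInterval), dist ((F (m + 1) z : A) : ι → ℝ) p0 ≤ (m + 2 : ℕ) := by
    intro m z
    have := hFb (m + 1) z; push_cast at *; linarith
  have hstep := fun (m : ℕ) (z : A × A × unitInterval) => hF (m + 2) (h m z) (F (m + 1) z) (hb m z) (hb' m z)
  have h2 : ∀ m : ℕ, (1 : ℝ) ≤ 2 ^ m := fun m => one_le_pow₀ (by norm_num)
  -- closeness to target sets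
  have hT : ∀ (k : ℕ) z (T : Set (ι → ℝ)), N z < k + 1 → k ≤ N z →
      (∀ m : ℕ, N z ≤ m → Nr (δ / 16 / 2 ^ m) T (F m z)) → ∀ n,
      Nr (δ / 16 * (4 - 2 / 2 ^ (n + k + 1))) T (h (n + k + 1) z) := by
    intro k z T hk1 hk2 hT n
    induction n with
    | zero =>
      have e := (hstep k z).2.1
      have hm : μ (k + 1) z = 1 := by
        simp only [μ]; exact Set.projIcc_of_right_le _ (by push_cast; linarith)
      rw [zero_add, hs, hm]
      refine (e.trans (ε' := δ / 16 / 2 ^ (k + 1)) ?_).mono subset_rfl ?_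
      · rintro _ rfl
        exact hT (k + 1) (by push_cast; linarith)
      · have := h2 k
        have e1 : (1 : ℝ) / 2 ^ k ≤ 1 := by rw [div_le_one (by positivity)]; exact this
        have e2 : δ / 16 * (1 / 2 ^ k) ≤ δ / 16 * 1 := mul_le_mul_of_nonneg_left e1 (by positivity)
        have e3 : δ / 16 / 2 ^ (k + 2) + δ / 16 / 2 ^ (k + 1) = 3 / 4 * (δ / 16 * (1 / 2 ^ k)) := by
          rw [pow_add, pow_add]; field_simp; norm_num
        have e4 : δ / 16 * (4 - 2 / 2 ^ (k + 1)) = δ / 4 - δ / 16 * (1 / 2 ^ k) := by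
          rw [pow_add]; field_simp; ring
        rw [e3, e4]; linarith
    | succ n ih =>
      set m := n + k + 1 with hm
      have hm' : n + 1 + k + 1 = m + 1 := by omega
      have hmk : ((k : ℝ) + 1) ≤ m := by rw [hm]; push_cast; linarith [(Nat.cast_nonneg n : (0:ℝ) ≤ n)]
      rw [hm', hs]
      have := h2 m
      have e1 : (1 : ℝ) / 2 ^ m ≤ 1 := by rw [div_le_one (by positivity)]; exact this
      have e0 : 0 < δ / 16 * (1 / 2 ^ m) := by positivity
      have e2 : δ / 16 * (1 / 2 ^ m) ≤ δ / 16 * 1 := mul_le_mul_of_nonneg_left e1 (by positivity)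
      refine (((hstep m z).2.2 (μ (m + 1) z)).trans (ε' := δ / 16 * (4 - 2 / 2 ^ m)) ?_).mono
        subset_rfl ?_
      · intro q hq
        rcases hq with rfl | hq
        · exact ih
        · rw [Set.mem_singleton_iff] at hq
          rw [hq]
          refine (hT (m + 1) (by push_cast; linarith)).mono subset_rfl ?_
          have e3 : δ / 16 / 2 ^ (m + 1) = 1 / 2 * (δ / 16 * (1 / 2 ^ m)) := by
            rw [pow_succ]; field_simp
          have e4 : δ / 16 * (4 - 2 / 2 ^ m) = δ / 4 - 2 * (δ / 16 * (1 / 2 ^ m)) := by ring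
          rw [e3, e4]; linarith
      · have e3 : δ / 16 / 2 ^ (m + 2) = 1 / 4 * (δ / 16 * (1 / 2 ^ m)) := by
          rw [pow_add]; field_simp; norm_num
        have e4 : δ / 16 * (4 - 2 / 2 ^ m) = δ / 4 - 2 * (δ / 16 * (1 / 2 ^ m)) := by ring
        have e5 : δ / 16 * (4 - 2 / 2 ^ (m + 1)) = δ / 4 - (δ / 16 * (1 / 2 ^ m)) := by
          rw [pow_succ]; field_simp; ring
        rw [e3, e4, e5]; linarith
  -- convergence
  have hd : ∀ (k : ℕ) z, N z < k + 1 → ∀ n : ℕ,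
      dist (h (n + (k + 2)) z : ι → ℝ) (h (n + 1 + (k + 2)) z) ≤ δ / 2 / 2 / 2 ^ n := by
    intro k z hk n
    have e : n + 1 + (k + 2) = n + (k + 2) + 1 := by omega
    have hm : μ (n + (k + 2) + 1) z = 0 := by
      simp only [μ]
      refine Set.projIcc_of_le_left _ ?_
      push_cast
      linarith [(Nat.cast_nonneg n : (0:ℝ) ≤ n)]
    have e1 := (hstep (n + (k + 2)) z).1
    rw [e, hs, hm, dist_comm]
    have hp : 0 < δ / 16 / 2 ^ (n + (k + 2) + 2) := by positivity
    refine (e1.dist_le (η := 0) ?_ (by linarith)).trans ?_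
    · rintro _ rfl; simp
    · rw [add_zero]
      have : δ / 2 / 2 / 2 ^ n = δ / 4 / 2 ^ n := by ring
      rw [this]
      exact div_le_div₀ (by positivity) (by linarith) (by positivity)
        (pow_le_pow_right₀ (by norm_num) (by omega))
  have hk : ∀ z, ∃ k : ℕ, (k : ℝ) ≤ N z ∧ N z < k + 1 := fun z =>
    ⟨⌊N z⌋₊, Nat.floor_le (hN0 z), Nat.lt_floor_add_one _⟩
  have hlim : ∀ z, ∃ p : ι → ℝ, Filter.Tendsto (fun n => (h n z : ι → ℝ)) Filter.atTop (nhds p) := by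
    intro z
    obtain ⟨k, _, hk⟩ := hk z
    obtain ⟨p, hp⟩ := cauchySeq_tendsto_of_complete (cauchySeq_of_le_geometric_two (hd k z hk))
    exact ⟨p, (Filter.tendsto_add_atTop_iff_nat (f := fun n => (h n z : ι → ℝ)) (k + 2)).1 hp⟩
  choose g hg using hlim
  have hdist : ∀ (k : ℕ) z, N z < k + 1 → ∀ n : ℕ,
      dist (h (n + (k + 2)) z : ι → ℝ) (g z) ≤ δ / 2 / 2 ^ n := fun k z hk n =>
    dist_le_of_le_geometric_two_of_tendsto (hd k z hk)
      ((Filter.tendsto_add_atTop_iff_nat (f := fun n => (h n z : ι → ℝ)) (k + 2)).2 (hg z)) n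
  have hgA : ∀ z, g z ∈ A := fun z => hc.mem_of_tendsto (hg z)
    (Filter.Eventually.of_forall fun n => (h n z).2)
  have hgc : Continuous g := by
    refine continuous_of_locally_uniform_approx_of_continuousAt fun z U hU => ?_
    obtain ⟨η, hη, hU⟩ := Metric.mem_uniformity_dist.1 hU
    obtain ⟨k, _, hk⟩ := hk z
    obtain ⟨n, hn⟩ := exists_pow_lt_of_lt_one (show 0 < η / δ by positivity)
      (show (1 / 2 : ℝ) < 1 by norm_num)
    refine ⟨{z | N z < k + 1}, (isOpen_lt hN continuous_const).mem_nhds hk,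
      fun z => (h (n + (k + 2)) z : ι → ℝ),
      (continuous_subtype_val.comp (hcont _)).continuousAt, fun y hy => ?_⟩
    apply hU
    rw [dist_comm]
    refine (hdist k y hy n).trans_lt ?_
    rw [lt_div_iff₀ hδ, one_div, inv_pow] at hn
    have e : δ / 2 / 2 ^ n = 1 / 2 * ((2 ^ n)⁻¹ * δ) := by field_simp
    have : 0 < (2 ^ n)⁻¹ * δ := by positivity
    rw [e]; linarith
  have hfin : ∀ z (T : Set (ι → ℝ)),
      (∀ m : ℕ, N z ≤ m → Nr (δ / 16 / 2 ^ m) T (F m z)) → Nr δ T (g z) := by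
    intro z T hz
    obtain ⟨k, hk1, hk2⟩ := hk z
    have a1 := hT k z T hk2 hk1 hz 1
    have a2 := hdist k z hk2 0
    have e : 1 + k + 1 = 0 + (k + 2) := by omega
    rw [e] at a1
    rw [dist_comm] at a2
    have a3 : Nr (δ / 2 / 2 ^ 0) {(h (0 + (k + 2)) z : ι → ℝ)} (g z) := Nr.of_dist rfl a2
    refine (a3.trans (ε' := δ / 16 * (4 - 2 / 2 ^ (0 + (k + 2)))) ?_).mono subset_rfl ?_
    · rintro _ rfl
      exact a1
    · have : 0 < δ / 16 * (2 / 2 ^ (0 + (k + 2))) := by positivity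
      rw [mul_sub, pow_zero, div_one]
      linarith
  refine ⟨fun z => ⟨g z, hgA z⟩, hgc.subtype_mk _, fun x y => ⟨?_, ?_, fun t => ?_⟩⟩
  · exact hfin (x, y, 0) _ fun m hm => (hF m x y ((le_max_left _ _).trans hm)
      ((le_max_right _ _).trans hm)).1
  · exact hfin (x, y, 1) _ fun m hm => (hF m x y ((le_max_left _ _).trans hm)
      ((le_max_right _ _).trans hm)).2.1
  · exact hfin (x, y, t) _ fun m hm => (hF m x y ((le_max_left _ _).trans hm)
      ((le_max_right _ _).trans hm)).2.2 t

theorem closed_monovex_approx_path {n : ℕ} (A : Set (Fin n → ℝ))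
    (hne : A.Nonempty) (hc : IsClosed A) (hA : Monovex A) (δ : ℝ) (hδ : 0 < δ) :
    ∃ g : A × A × unitInterval → A, Continuous g ∧
      ∀ x y : A,
        dist (x : Fin n → ℝ) (g (x, y, 0) : Fin n → ℝ) ≤ δ ∧
        dist (y : Fin n → ℝ) (g (x, y, 1) : Fin n → ℝ) ≤ δ ∧
        ∀ t : unitInterval,
          Metric.infDist (g (x, y, t) : Fin n → ℝ)
            (Set.pi Set.univ fun i =>
              Set.Icc (min ((x : Fin n → ℝ) i) ((y : Fin n → ℝ) i))
                (max ((x : Fin n → ℝ) i) ((y : Fin n → ℝ) i))) ≤ δ := by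
  obtain ⟨p0, hp0⟩ := hne
  obtain ⟨g, hg, h⟩ := exG hc hA hp0 hδ
  refine ⟨g, hg, fun x y => ?_⟩
  obtain ⟨h1, h2, h3⟩ := h x y
  refine ⟨?_, ?_, fun t => ?_⟩
  · rw [dist_comm]
    have := h1.dist_le (p0 := (x : Fin n → ℝ)) (η := 0) (by rintro _ rfl; simp) (by linarith)
    linarith
  · rw [dist_comm]
    have := h2.dist_le (p0 := (y : Fin n → ℝ)) (η := 0) (by rintro _ rfl; simp) (by linarith)
    linarith
  · have h4 := h3 t
    set p : Fin n → ℝ := (g (x, y, t) : Fin n → ℝ)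
    let q : Fin n → ℝ := fun i => max (min ((x : Fin n → ℝ) i) ((y : Fin n → ℝ) i))
      (min (max ((x : Fin n → ℝ) i) ((y : Fin n → ℝ) i)) (p i))
    refine (Metric.infDist_le_dist_of_mem (y := q) ?_).trans ?_
    · intro i _
      exact ⟨le_max_left _ _, max_le (min_le_max) (min_le_left _ _)⟩
    · rw [dist_pi_le_iff hδ.le]
      intro i
      obtain ⟨⟨a, ha, ha'⟩, ⟨b, hb, hb'⟩⟩ := h4 i
      have l1 : min ((x : Fin n → ℝ) i) ((y : Fin n → ℝ) i) ≤ p i + δ := by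
        rcases ha with rfl | ha
        · exact (min_le_left _ _).trans ha'
        · rw [Set.mem_singleton_iff] at ha
          rw [ha] at ha'
          exact (min_le_right _ _).trans ha'
      have l2 : p i ≤ max ((x : Fin n → ℝ) i) ((y : Fin n → ℝ) i) + δ := by
        rcases hb with rfl | hb
        · linarith [le_max_left ((x : Fin n → ℝ) i) ((y : Fin n → ℝ) i)]
        · rw [Set.mem_singleton_iff] at hb
          rw [hb] at hb'
          linarith [le_max_right ((x : Fin n → ℝ) i) ((y : Fin n → ℝ) i)]
      rw [Real.dist_eq, abs_le]
      have l3 : q i ≤ p i + δ := max_le l1 ((min_le_right _ _).trans (by linarith))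
      have l4 : p i - δ ≤ q i := (le_min (by linarith) (by linarith)).trans (le_max_right _ _)
      constructor <;> linarith
end

section
/- Every nonempty closed monovex set A ⊆ ℝ^n is a retract of ℝ^n: there exists a continuous function h : ℝ^n → A such that h(x) = x for every x ∈ A. -/
open Set Filter Topology

lemma mvx_fiber_convex {n : ℕ} {S : Set (Fin (n+1) → ℝ)} (hS : Monovex S) (p : Fin n → ℝ) :
    Convex ℝ {t : ℝ | (Fin.cons t p : Fin (n+1) → ℝ) ∈ S} := by
  rw [convex_iff_ordConnected]
  refine ⟨fun a ha b hb c hcab => ?_⟩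
  obtain ⟨γ, hγ, h0, h1, hm, hmon⟩ := hS _ ha _ hb
  have hcont : Continuous (fun t => γ t 0) := by fun_prop
  have h00 : γ 0 0 = a := by rw [h0]; simp
  have h10 : γ 1 0 = b := by rw [h1]; simp
  have hmem : c ∈ Icc (γ 0 0) (γ 1 0) := by rw [h00, h10]; exact hcab
  obtain ⟨t, ht⟩ := intermediate_value_univ (0 : unitInterval) 1 hcont hmem
  have : γ t = Fin.cons c p := by
    funext i
    refine Fin.cases ?_ (fun j => ?_) i
    · simpa using ht
    · have e0 : γ 0 j.succ = p j := by rw [h0]; simp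
      have e1 : γ 1 j.succ = p j := by rw [h1]; simp
      have t0 : (0 : unitInterval) ≤ t := t.2.1
      have t1 : t ≤ (1 : unitInterval) := t.2.2
      rw [Fin.cons_succ]
      rcases hmon j.succ with h | h
      · have u := h t0
        have v := h t1
        simp only at u v
        linarith
      · have u := h t0
        have v := h t1
        simp only at u v
        linarith
  show Fin.cons c p ∈ S
  rw [← this]
  exact hm t

lemma mvx_proj {n : ℕ} {S : Set (Fin (n+1) → ℝ)} (hS : Monovex S) :
    Monovex {p : Fin n → ℝ | ∃ t : ℝ, (Fin.cons t p : Fin (n+1) → ℝ) ∈ S} := by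
  rintro x ⟨a, ha⟩ y ⟨b, hb⟩
  obtain ⟨γ, hγ, h0, h1, hm, hmon⟩ := hS _ ha _ hb
  refine ⟨fun t j => γ t j.succ, by fun_prop, ?_, ?_, fun t => ⟨γ t 0, ?_⟩, fun i => hmon i.succ⟩
  · funext j; simp [h0]
  · funext j; simp [h1]
  · have : (Fin.cons (γ t 0) (fun j => γ t (Fin.succ j)) : Fin (n+1) → ℝ) = γ t :=
      Fin.cons_self_tail (γ t)
    rw [this]; exact hm t

lemma mvx_sel_one {X : Type*} [MetricSpace X] {C : Set X} (hC : IsClosed C)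
    (Φ : Set (X × ℝ)) (hΦ : IsOpen Φ) (hconv : ∀ x, Convex ℝ {t | (x, t) ∈ Φ})
    (hne : ∀ x, ∃ t, (x, t) ∈ Φ) (f : X → ℝ) (hf : Continuous f) (hfC : ∀ x ∈ C, (x, f x) ∈ Φ) :
    ∃ g : X → ℝ, Continuous g ∧ (∀ x, (x, g x) ∈ Φ) ∧ ∀ x ∈ C, g x = f x := by
  obtain ⟨g, hg⟩ := exists_continuous_forall_mem_convex_of_local (E := ℝ)
    (t := fun x => {t | (x, t) ∈ Φ ∧ (x ∈ C → t = f x)}) (fun x => by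
      by_cases hx : x ∈ C
      · have : {t | (x, t) ∈ Φ ∧ (x ∈ C → t = f x)} = {t | (x, t) ∈ Φ} ∩ {f x} := by
          ext t; simp [hx]
        rw [this]
        exact (hconv x).inter (convex_singleton _)
      · simpa [hx] using hconv x) (fun x => by
      by_cases hx : x ∈ C
      · refine ⟨{y | (y, f y) ∈ Φ}, ?_, f, hf.continuousOn, fun y hy => ⟨hy, fun _ => rfl⟩⟩
        exact (hΦ.preimage (by fun_prop : Continuous fun y => (y, f y))).mem_nhds (hfC x hx)
      · obtain ⟨c, hc⟩ := hne x
        refine ⟨{y | (y, c) ∈ Φ} ∩ Cᶜ, ?_, fun _ => c, continuousOn_const,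
          fun y hy => ⟨hy.1, fun h => (hy.2 h).elim⟩⟩
        exact ((hΦ.preimage (by fun_prop : Continuous fun y => (y, c))).inter
          hC.isOpen_compl).mem_nhds ⟨hc, hx⟩)
  exact ⟨g, g.continuous, fun x => (hg x).1, fun x hx => (hg x).2 hx⟩

lemma mvx_sel {X : Type*} [MetricSpace X] {C : Set X} (hC : IsClosed C) :
    ∀ (n : ℕ) (Φ : Set (X × (Fin n → ℝ))), IsOpen Φ → (∀ x, Monovex {v | (x, v) ∈ Φ}) →
    (∀ x, ∃ v, (x, v) ∈ Φ) → ∀ f : X → Fin n → ℝ, Continuous f → (∀ x ∈ C, (x, f x) ∈ Φ) →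
    ∃ g : X → Fin n → ℝ, Continuous g ∧ (∀ x, (x, g x) ∈ Φ) ∧ ∀ x ∈ C, g x = f x := by
  intro n
  induction n with
  | zero =>
    intro Φ hΦ hm hne f hf hfC
    refine ⟨f, hf, fun x => ?_, fun _ _ => rfl⟩
    obtain ⟨v, hv⟩ := hne x
    rwa [Subsingleton.elim (f x) v]
  | succ n ih =>
    intro Φ hΦ hm hne f hf hfC
    have hcons : ∀ v : Fin (n+1) → ℝ,
      (Fin.cons (v 0) (fun j => v (Fin.succ j)) : Fin (n+1) → ℝ) = v := fun v =>
      Fin.cons_self_tail v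
    have hcc : Continuous (fun q : ℝ × (Fin n → ℝ) => (Fin.cons q.1 q.2 : Fin (n+1) → ℝ)) := by
      refine continuous_pi fun i => ?_
      refine Fin.cases ?_ (fun j => ?_) i
      · simpa using continuous_fst
      · simp only [Fin.cons_succ]; fun_prop
    obtain ⟨g', hg', hgΦ, hgC⟩ := ih
      {q | ∃ t : ℝ, (q.1, (Fin.cons t q.2 : Fin (n+1) → ℝ)) ∈ Φ}
      (by
        rw [ofPred_exists]
        refine isOpen_iUnion fun t => hΦ.preimage ?_
        exact continuous_fst.prodMk (hcc.comp (continuous_const.prodMk continuous_snd)))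
      (fun x => mvx_proj (hm x))
      (fun x => by
        obtain ⟨v, hv⟩ := hne x
        exact ⟨fun j => v j.succ, v 0, by rw [hcons]; exact hv⟩)
      (fun x j => f x j.succ) (by fun_prop)
      (fun x hx => ⟨f x 0, by rw [hcons]; exact hfC x hx⟩)
    obtain ⟨g0, hg0, hg0Φ, hg0C⟩ := mvx_sel_one hC
      {q : X × ℝ | (q.1, (Fin.cons q.2 (g' q.1) : Fin (n+1) → ℝ)) ∈ Φ}
      (by
        refine hΦ.preimage ?_
        exact continuous_fst.prodMk (hcc.comp (continuous_snd.prodMk (hg'.comp continuous_fst))))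
      (fun x => mvx_fiber_convex (hm x) (g' x))
      (fun x => hgΦ x) (fun x => f x 0) (by fun_prop)
      (fun x hx => by
        show (x, (Fin.cons (f x 0) (g' x) : Fin (n+1) → ℝ)) ∈ Φ
        rw [hgC x hx, hcons]; exact hfC x hx)
    refine ⟨fun x => Fin.cons (g0 x) (g' x), hcc.comp (hg0.prodMk hg'), hg0Φ, fun x hx => ?_⟩
    simp only [hgC x hx, hg0C x hx, hcons]

lemma mvx_thick {n : ℕ} {A : Set (Fin n → ℝ)} (hA : Monovex A) (ε : ℝ) (c : Fin n → ℝ) (δ : ℝ)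
    (hδ : 0 < δ) :
    Monovex (Metric.thickening ε A ∩ Metric.ball c δ) := by
  rintro z ⟨hz, hzc⟩ w ⟨hw, hwc⟩
  rw [Metric.mem_thickening_iff] at hz hw
  obtain ⟨x, hx, hzx⟩ := hz
  obtain ⟨y, hy, hwy⟩ := hw
  obtain ⟨γ, hγ, h0, h1, hm, hmon⟩ := hA x hx y hy
  set e := max (dist z x) (dist w y) with he
  have hee : e < ε := max_lt hzx hwy
  have he0 : 0 ≤ e := dist_nonneg.trans (le_max_left _ _)
  have hzi : ∀ i, |z i - x i| ≤ e := fun i => (dist_le_pi_dist z x i).trans (le_max_left _ _)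
  have hwi : ∀ i, |w i - y i| ≤ e := fun i => (dist_le_pi_dist w y i).trans (le_max_right _ _)
  let l : unitInterval → Fin n → ℝ := fun t i => z i + t * (w i - z i)
  let τ : unitInterval → Fin n → ℝ := fun t i => max (γ t i - e) (min (γ t i + e) (l t i))
  have hl : Continuous l := by fun_prop
  have hτ0 : τ 0 = z := by
    funext i
    have := abs_le.1 (hzi i)
    simp only [τ, l, h0]
    simp only [Set.Icc.coe_zero, zero_mul, add_zero]
    rw [min_eq_right (by linarith), max_eq_right (by linarith)]
  have hτ1 : τ 1 = w := by
    funext i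
    have := abs_le.1 (hwi i)
    simp only [τ, l, h1]
    simp only [Set.Icc.coe_one, one_mul, add_sub_cancel]
    rw [min_eq_right (by linarith), max_eq_right (by linarith)]
  have hb : ∀ (i) (t : unitInterval), (x i ≤ γ t i ∧ γ t i ≤ y i) ∨ (y i ≤ γ t i ∧ γ t i ≤ x i) := by
    intro i t
    have t0 : (0 : unitInterval) ≤ t := t.2.1
    have t1 : t ≤ (1 : unitInterval) := t.2.2
    rcases hmon i with h | h
    · have u := h t0
      have v := h t1
      simp only [h0, h1] at u v
      exact Or.inl ⟨u, v⟩
    · have u := h t0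
      have v := h t1
      simp only [h0, h1] at u v
      exact Or.inr ⟨v, u⟩
  have hlb : ∀ (i) (t : unitInterval), (z i ≤ w i → z i ≤ l t i ∧ l t i ≤ w i) ∧
      (w i ≤ z i → w i ≤ l t i ∧ l t i ≤ z i) := by
    intro i t
    have t0 := t.2.1
    have t1 := t.2.2
    simp only [l]
    constructor <;> intro h <;> constructor <;> nlinarith
  have hlm : ∀ i, (z i ≤ w i → Monotone fun t => l t i) ∧ (w i ≤ z i → Antitone fun t => l t i) := by
    intro i
    constructor
    · intro h s t hst
      have : (s : ℝ) ≤ t := hst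
      simp only [l]
      nlinarith
    · intro h s t hst
      have : (s : ℝ) ≤ t := hst
      simp only [l]
      nlinarith
  -- opposite directions: no clamping occurs
  have hno : ∀ i, (x i ≤ y i ∧ w i ≤ z i) ∨ (y i ≤ x i ∧ z i ≤ w i) → ∀ t, τ t i = l t i := by
    intro i hi t
    have a1 := abs_le.1 (hwi i)
    have a2 := abs_le.1 (hzi i)
    have a3 := hlb i t
    simp only [τ]
    rcases hi with ⟨p, q⟩ | ⟨p, q⟩
    · have a4 := a3.2 q
      have a5 : x i ≤ γ t i ∧ γ t i ≤ y i := by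
        rcases hb i t with h | h
        · exact h
        · constructor <;> linarith
      rw [min_eq_right (by linarith), max_eq_right (by linarith)]
    · have a4 := a3.1 q
      have a5 : y i ≤ γ t i ∧ γ t i ≤ x i := by
        rcases hb i t with h | h
        · constructor <;> linarith
        · exact h
      rw [min_eq_right (by linarith), max_eq_right (by linarith)]
  have hτm : ∀ i, Monotone (fun t => τ t i) ∨ Antitone (fun t => τ t i) := by
    intro i
    have e0 : γ 0 i = x i := by rw [h0]
    have e1 : γ 1 i = y i := by rw [h1]
    have h01 : (0 : unitInterval) ≤ 1 := zero_le_one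
    rcases le_total (z i) (w i) with q | q
    · left
      rcases hmon i with h | h
      · intro s t hst
        have u : γ s i ≤ γ t i := h hst
        have v : l s i ≤ l t i := (hlm i).1 q hst
        simp only [τ]
        gcongr
      · have p : y i ≤ x i := by rw [← e0, ← e1]; exact h h01
        simp only [hno i (Or.inr ⟨p, q⟩)]
        exact (hlm i).1 q
    · right
      rcases hmon i with h | h
      · have p : x i ≤ y i := by rw [← e0, ← e1]; exact h h01
        simp only [hno i (Or.inl ⟨p, q⟩)]
        exact (hlm i).2 q
      · intro s t hst
        have u : γ t i ≤ γ s i := h hst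
        have v : l t i ≤ l s i := (hlm i).2 q hst
        simp only [τ]
        gcongr
  refine ⟨τ, ?_, hτ0, hτ1, fun t => ⟨?_, ?_⟩, hτm⟩
  · have : ∀ i, Continuous fun t => γ t i := fun i => by fun_prop
    fun_prop
  · rw [Metric.mem_thickening_iff]
    refine ⟨γ t, hm t, lt_of_le_of_lt ?_ hee⟩
    rw [dist_pi_le_iff he0]
    intro i
    rw [Real.dist_eq, abs_le]
    have b1 : γ t i - e ≤ τ t i := le_max_left _ _
    have b2 : τ t i ≤ γ t i + e := max_le (by linarith) (min_le_left _ _)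
    constructor <;> linarith
  · rw [Metric.mem_ball, dist_pi_lt_iff hδ] at hzc hwc ⊢
    intro i
    have c1 := abs_lt.1 (hzc i)
    have c2 := abs_lt.1 (hwc i)
    have t0 : (0 : unitInterval) ≤ t := t.2.1
    have t1 : t ≤ (1 : unitInterval) := t.2.2
    rw [Real.dist_eq, abs_lt]
    rcases hτm i with h | h
    · have u := h t0
      have v := h t1
      simp only [hτ0, hτ1] at u v
      constructor <;> linarith
    · have u := h t0
      have v := h t1
      simp only [hτ0, hτ1] at u v
      constructor <;> linarith

lemma mvx_step {n : ℕ} {A : Set (Fin n → ℝ)} (hc : IsClosed A) (hA : Monovex A)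
    (ε : ℝ) (hε : 0 < ε) (δ : (Fin n → ℝ) → ℝ) (hδc : Continuous δ) (hδ : ∀ x, 0 < δ x)
    (r : (Fin n → ℝ) → (Fin n → ℝ))
    (hr : Continuous r) (hrδ : ∀ x, ∃ a ∈ A, dist (r x) a < δ x) (hrA : ∀ x ∈ A, r x = x) :
    ∃ g : (Fin n → ℝ) → (Fin n → ℝ), (Continuous g ∧ (∀ x, ∃ a ∈ A, dist (g x) a < ε) ∧
      (∀ x ∈ A, g x = x)) ∧ ∀ x, dist (r x) (g x) < δ x := by
  obtain ⟨g, hg, hgΦ, hgA⟩ := mvx_sel hc n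
    {q | q.2 ∈ Metric.thickening ε A ∩ Metric.ball (r q.1) (δ q.1)}
    (by
      refine (Metric.isOpen_thickening.preimage continuous_snd).inter ?_
      exact isOpen_lt (f := fun q : (Fin n → ℝ) × (Fin n → ℝ) => dist q.2 (r q.1))
        (g := fun q => δ q.1) (by fun_prop) (by fun_prop))
    (fun x => mvx_thick hA ε (r x) (δ x) (hδ x))
    (fun x => by
      obtain ⟨a, ha, hra⟩ := hrδ x
      exact ⟨a, Metric.self_subset_thickening hε A ha, by rw [Metric.mem_ball, dist_comm]; exact hra⟩)
    id continuous_id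
    (fun x hx => ⟨Metric.self_subset_thickening hε A hx, by
      simp only [id, hrA x hx]; exact Metric.mem_ball_self (hδ x)⟩)
  exact ⟨g, ⟨hg, fun x => Metric.mem_thickening_iff.1 (hgΦ x).1, hgA⟩, fun x => by
    rw [dist_comm]; exact (hgΦ x).2⟩

theorem closed_monovex_retract {n : ℕ} (A : Set (Fin n → ℝ))
    (hne : A.Nonempty) (hc : IsClosed A) (hA : Monovex A) :
    ∃ h : (Fin n → ℝ) → (Fin n → ℝ), Continuous h ∧
      (∀ x, h x ∈ A) ∧ ∀ x ∈ A, h x = x := by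
  let P : ℕ → ((Fin n → ℝ) → (Fin n → ℝ)) → Prop := fun k r =>
    Continuous r ∧ (∀ x, ∃ a ∈ A, dist (r x) a < 1 / 2 ^ k) ∧ (∀ x ∈ A, r x = x)
  obtain ⟨r0, hr0, -⟩ : ∃ r, P 0 r ∧ ∀ x, dist (id x) (r x) < Metric.infDist x A + 1 :=
    mvx_step hc hA (1 / 2 ^ 0) (by positivity) (fun x => Metric.infDist x A + 1)
      ((Metric.continuous_infDist_pt A).add continuous_const)
      (fun x => by have := Metric.infDist_nonneg (x := x) (s := A); linarith) id continuous_id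
      (fun x => (Metric.infDist_lt_iff hne).1 (lt_add_one _)) (fun _ _ => rfl)
  have hstep : ∀ k (r : {r // P k r}), ∃ g, P (k+1) g ∧ ∀ x, dist (r.1 x) (g x) < 1 / 2 ^ k :=
    fun k r => mvx_step hc hA (1 / 2 ^ (k+1)) (by positivity) (fun _ => 1 / 2 ^ k)
      continuous_const (fun _ => by positivity) r.1 r.2.1 r.2.2.1 r.2.2.2
  choose G hGP hGd using hstep
  let R : ∀ k, {r // P k r} := fun k => Nat.rec ⟨r0, hr0⟩ (fun k r => ⟨G k r, hGP k r⟩) k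
  have hd : ∀ x k, dist ((R k).1 x) ((R (k+1)).1 x) ≤ 2 / 2 / 2 ^ k := fun x k => by
    have := (hGd k (R k) x).le
    rw [div_self two_ne_zero]
    exact this
  have hlim : ∀ x, ∃ y, Tendsto (fun k => (R k).1 x) atTop (𝓝 y) := fun x =>
    cauchySeq_tendsto_of_complete (cauchySeq_of_le_geometric_two (hd x))
  choose h hh using hlim
  have hz : Tendsto (fun k : ℕ => (2 : ℝ) / 2 ^ k) atTop (𝓝 0) := by
    have := (tendsto_pow_atTop_nhds_zero_of_lt_one (r := (1/2 : ℝ)) (by norm_num)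
      (by norm_num)).const_mul 2
    simpa [div_eq_mul_inv] using this
  have hdl : ∀ x k, dist ((R k).1 x) (h x) ≤ 2 / 2 ^ k := fun x k =>
    dist_le_of_le_geometric_two_of_tendsto (hd x) (hh x) k
  refine ⟨h, ?_, fun x => ?_, fun x hx => ?_⟩
  · have hu : TendstoUniformly (fun k => (R k).1) h atTop := by
      rw [Metric.tendstoUniformly_iff]
      intro ε hε
      filter_upwards [hz.eventually_lt_const hε] with k hk x
      rw [dist_comm]
      exact (hdl x k).trans_lt hk
    exact hu.continuous (Frequently.of_forall fun k => (R k).2.1)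
  · rw [← hc.closure_eq, Metric.mem_closure_iff]
    intro ε hε
    obtain ⟨k, hk⟩ := (hz.eventually_lt_const (half_pos hε)).exists
    obtain ⟨a, ha, had⟩ := (R k).2.2.1 x
    refine ⟨a, ha, ?_⟩
    have h1 := hdl x k
    have h2 := dist_triangle_left (h x) a ((R k).1 x)
    have h3 : (1 : ℝ) / 2 ^ k ≤ 2 / 2 ^ k := by gcongr; norm_num
    linarith
  · refine tendsto_nhds_unique (hh x) ?_
    have : (fun k => (R k).1 x) = fun _ => x := funext fun k => (R k).2.2.2 x hx
    rw [this]
    exact tendsto_const_nhds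
end
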